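/- Let c > 0 and ζ ∈ ℝ. Define q*(λ) = exp(2c · max(0, ζ)) · (2πλ)^{-1/2} · exp(−(λ + cζ)²/(2λ)) for λ > 0. Then q* is a probability density on (0, ∞), and ∫₀^∞ q*(λ) [ log q*(λ) + (1/2) log(2πλ) + (λ + cζ)²/(2λ) ] dλ = 2c · max(0, ζ); that is, the variational upper bound on the hinge loss is tight, achieved by q*. Consequently the infimum over all probability densities q on (0, ∞) of ∫₀^∞ q(λ) [ log q(λ) + (1/2) log(2πλ) + (λ + cζ)²/(2λ) ] dλ equals 2c · max(0, ζ). -/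

import Mathlib

open MeasureTheory Real

open Filter Topology Set in
/-- The integral over `(a, ∞)` of a nonnegative derivative is the difference of the one-sided
limits of the primitive. -/
theorem integral_Ioi_of_hasDerivAt_of_nonneg_of_tendsto {g g' : ℝ → ℝ} {a m l : ℝ}
    (hderiv : ∀ x ∈ Ioi a, HasDerivAt g (g' x) x) (g'pos : ∀ x ∈ Ioi a, 0 ≤ g' x)
    (hm : Tendsto g (𝓝[>] a) (𝓝 m)) (hl : Tendsto g atTop (𝓝 l)) :
    ∫ x in Ioi a, g' x = l - m := by
  classical
  have hcont : ContinuousWithinAt (Function.update g a m) (Ici a) a := by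
    rw [continuousWithinAt_update_same]
    simpa using hm
  have hderiv' : ∀ x ∈ Ioi a, HasDerivAt (Function.update g a m) (g' x) x := fun x hx =>
    (hderiv x hx).congr_of_eventuallyEq <| by
      filter_upwards [Ioi_mem_nhds hx] with y hy
      exact Function.update_of_ne (ne_of_gt hy) _ _
  have hl' : Tendsto (Function.update g a m) atTop (𝓝 l) := by
    refine hl.congr' ?_
    filter_upwards [Ioi_mem_atTop a] with y hy
    exact (Function.update_of_ne (ne_of_gt hy) _ _).symm
  simpa using integral_Ioi_of_hasDerivAt_of_nonneg hcont hderiv' g'pos hl'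

/-- The primitive of the unnormalized standard Gaussian density vanishing at `0`. -/
noncomputable def gaussianPrimitive (x : ℝ) : ℝ := ∫ t in (0 : ℝ)..x, exp (-(1 / 2) * t ^ 2)

theorem hasDerivAt_gaussianPrimitive (x : ℝ) :
    HasDerivAt gaussianPrimitive (exp (-(1 / 2) * x ^ 2)) x := by
  have hc : Continuous fun t : ℝ => exp (-(1 / 2) * t ^ 2) := by fun_prop
  exact intervalIntegral.integral_hasDerivAt_right (hc.intervalIntegrable _ _)
    (hc.stronglyMeasurableAtFilter _ _) hc.continuousAt

theorem gaussianPrimitive_neg (x : ℝ) : gaussianPrimitive (-x) = -gaussianPrimitive x := by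
  unfold gaussianPrimitive
  have h := intervalIntegral.integral_comp_neg (a := 0) (b := x)
    (fun t : ℝ => exp (-(1 / 2) * t ^ 2))
  simp only [neg_sq, neg_zero] at h
  rw [h, intervalIntegral.integral_symm]

open Filter Topology in
theorem tendsto_gaussianPrimitive_atTop :
    Tendsto gaussianPrimitive atTop (𝓝 (√(2 * π) / 2)) := by
  have h := intervalIntegral_tendsto_integral_Ioi (0 : ℝ)
    (integrable_exp_neg_mul_sq (b := 1 / 2) (by norm_num)).integrableOn tendsto_id
  rw [integral_gaussian_Ioi, show π / (1 / 2) = 2 * π by ring] at h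
  exact h

open Filter Topology in
theorem tendsto_gaussianPrimitive_atBot :
    Tendsto gaussianPrimitive atBot (𝓝 (-(√(2 * π) / 2))) := by
  refine (tendsto_gaussianPrimitive_atTop.comp tendsto_neg_atBot_atTop).neg.congr fun x => ?_
  simp [gaussianPrimitive_neg]

/-- A primitive of `exp (-(l - a) ^ 2 / (2 * l)) / √l` on `(0, ∞)`. -/
theorem hasDerivAt_gaussianPrimitive_sqrt_sub_add (a : ℝ) {l : ℝ} (hl : 0 < l) :
    HasDerivAt (fun l => gaussianPrimitive (√l - a * (√l)⁻¹) +
        exp (2 * a) * gaussianPrimitive (√l + a * (√l)⁻¹))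
      (exp (-(l - a) ^ 2 / (2 * l)) / √l) l := by
  have hs : 0 < √l := sqrt_pos.2 hl
  have hsq : √l ^ 2 = l := sq_sqrt hl.le
  have h1 := Real.hasDerivAt_sqrt hl.ne'
  have h2 := (h1.inv hs.ne').const_mul a
  have hu := (hasDerivAt_gaussianPrimitive _).comp l (h1.sub h2)
  have hv := ((hasDerivAt_gaussianPrimitive _).comp l (h1.add h2)).const_mul (exp (2 * a))
  refine (hu.add hv).congr_deriv ?_
  have e1 : exp (-(1 / 2) * (√l - a * (√l)⁻¹) ^ 2) = exp (-(l - a) ^ 2 / (2 * l)) := by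
    congr 1
    rw [← hsq]
    field_simp
    simp [hsq]
  have e2 : exp (2 * a) * exp (-(1 / 2) * (√l + a * (√l)⁻¹) ^ 2) =
      exp (-(l - a) ^ 2 / (2 * l)) := by
    rw [← exp_add]
    congr 1
    rw [← hsq]
    field_simp
    simp [hsq]
    ring
  simp only [Pi.sub_apply, Pi.add_apply, Pi.inv_apply]
  rw [← mul_assoc, e1, e2]
  field_simp
  ring

open Filter Topology in
theorem integral_exp_neg_sub_sq_div_sqrt {a : ℝ} (ha : 0 ≤ a) :
    ∫ l in Set.Ioi (0 : ℝ), exp (-(l - a) ^ 2 / (2 * l)) / √l = √(2 * π) := by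
  have hbot : Tendsto (fun l => gaussianPrimitive (√l - a * (√l)⁻¹) +
      exp (2 * a) * gaussianPrimitive (√l + a * (√l)⁻¹)) (𝓝[>] 0)
      (𝓝 (-(√(2 * π) / 2) + exp (2 * a) * (√(2 * π) / 2))) := by
    have hs : Tendsto (fun l : ℝ => √l) (𝓝[>] 0) (𝓝 0) := by
      simpa using (Real.continuous_sqrt.tendsto 0).mono_left nhdsWithin_le_nhds
    rcases ha.eq_or_lt with rfl | ha
    · have h0 : Tendsto gaussianPrimitive (𝓝 0) (𝓝 0) := by
        simpa [gaussianPrimitive] using (hasDerivAt_gaussianPrimitive 0).continuousAt.tendsto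
      have := h0.comp hs
      simpa using this.add this
    · have hi : Tendsto (fun l : ℝ => a * (√l)⁻¹) (𝓝[>] 0) atTop := by
        refine (tendsto_inv_nhdsGT_zero.comp ?_).const_mul_atTop ha
        refine tendsto_nhdsWithin_iff.2 ⟨hs, ?_⟩
        filter_upwards [self_mem_nhdsWithin] with l hl using sqrt_pos.2 hl
      refine (tendsto_gaussianPrimitive_atBot.comp ?_).add
        ((tendsto_gaussianPrimitive_atTop.comp (hs.add_atTop hi)).const_mul _)
      simpa [sub_eq_add_neg] using hs.add_atBot (tendsto_neg_atTop_atBot.comp hi)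
  have htop : Tendsto (fun l => gaussianPrimitive (√l - a * (√l)⁻¹) +
      exp (2 * a) * gaussianPrimitive (√l + a * (√l)⁻¹)) atTop
      (𝓝 (√(2 * π) / 2 + exp (2 * a) * (√(2 * π) / 2))) := by
    have hi : Tendsto (fun l : ℝ => a * (√l)⁻¹) atTop (𝓝 0) := by
      simpa using (tendsto_inv_atTop_zero.comp tendsto_sqrt_atTop).const_mul a
    refine (tendsto_gaussianPrimitive_atTop.comp ?_).add
      ((tendsto_gaussianPrimitive_atTop.comp (tendsto_sqrt_atTop.atTop_add hi)).const_mul _)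
    simpa [sub_eq_add_neg] using tendsto_sqrt_atTop.atTop_add hi.neg
  rw [integral_Ioi_of_hasDerivAt_of_nonneg_of_tendsto
    (fun l hl => hasDerivAt_gaussianPrimitive_sqrt_sub_add a hl) (fun l _ => by positivity)
    hbot htop]
  ring

/-- The pointwise Gibbs inequality. -/
theorem sub_le_mul_log_sub_log {x y : ℝ} (hx : 0 ≤ x) (hy : 0 < y) :
    x - y ≤ x * (log x - log y) := by
  rcases hx.eq_or_lt with rfl | hx
  · simpa using hy.le
  · have h := mul_le_mul_of_nonneg_left (one_sub_inv_le_log_of_pos (div_pos hx hy)) hx.le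
    rw [log_div hx.ne' hy.ne'] at h
    refine le_trans (le_of_eq ?_) h
    field_simp

/-- The variational upper bound on the hinge loss is tight: the density
`q*(λ) = exp(2c·max(0,ζ)) · (2πλ)^{-1/2} · exp(-(λ + cζ)²/(2λ))` is a probability
density on `(0,∞)`, achieves the value `2c·max(0,ζ)` in the variational objective,
and the infimum of the objective over all probability densities on `(0,∞)` (for
which the integrand is integrable) equals `2c·max(0,ζ)`. -/
theorem hinge_variational_bound_tight (c : ℝ) (hc : 0 < c) (ζ : ℝ) :
    let qs : ℝ → ℝ := fun l =>
      Real.exp (2 * c * max 0 ζ) *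
        ((2 * π * l) ^ (-(1 : ℝ) / 2) * Real.exp (-(l + c * ζ) ^ 2 / (2 * l)))
    ((∀ l ∈ Set.Ioi (0 : ℝ), 0 ≤ qs l) ∧ (∫ l in Set.Ioi (0 : ℝ), qs l = 1)) ∧
    (∫ l in Set.Ioi (0 : ℝ),
        qs l * (Real.log (qs l) + (1 / 2) * Real.log (2 * π * l) + (l + c * ζ) ^ 2 / (2 * l))
      = 2 * c * max 0 ζ) ∧
    sInf {r : ℝ | ∃ q : ℝ → ℝ, Measurable q ∧ (∀ l ∈ Set.Ioi (0 : ℝ), 0 ≤ q l) ∧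
        (∫ l in Set.Ioi (0 : ℝ), q l) = 1 ∧
        IntegrableOn (fun l =>
          q l * (Real.log (q l) + (1 / 2) * Real.log (2 * π * l) + (l + c * ζ) ^ 2 / (2 * l)))
          (Set.Ioi 0) ∧
        r = ∫ l in Set.Ioi (0 : ℝ),
          q l * (Real.log (q l) + (1 / 2) * Real.log (2 * π * l) + (l + c * ζ) ^ 2 / (2 * l))}
      = 2 * c * max 0 ζ := by

  intro qs
  have hM : 2 * c * max 0 ζ = c * ζ + |c * ζ| := by
    rw [abs_mul, abs_of_pos hc]
    rcases le_total 0 ζ with h | h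
    · rw [max_eq_right h, abs_of_nonneg h]; ring
    · rw [max_eq_left h, abs_of_nonpos h]; ring
  have hpos : ∀ l ∈ Set.Ioi (0 : ℝ), 0 < qs l := fun l hl => by
    have : 0 < 2 * π * l := mul_pos (by positivity) hl
    positivity
  have hlog : ∀ l ∈ Set.Ioi (0 : ℝ), log (qs l) + (1 / 2) * log (2 * π * l) +
      (l + c * ζ) ^ 2 / (2 * l) = 2 * c * max 0 ζ := fun l hl => by
    have h : 0 < 2 * π * l := mul_pos (by positivity) hl
    simp only [qs]
    rw [log_mul (by positivity) (by positivity), log_mul (by positivity) (by positivity),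
      log_exp, log_exp, log_rpow h]
    ring
  have hint : ∫ l in Set.Ioi (0 : ℝ), qs l = 1 := by
    have h : ∀ l ∈ Set.Ioi (0 : ℝ),
        qs l = (√(2 * π))⁻¹ * (exp (-(l - |c * ζ|) ^ 2 / (2 * l)) / √l) := fun l hl => by
      have hl0 : 0 < l := hl
      have hexp : 2 * c * max 0 ζ + -(l + c * ζ) ^ 2 / (2 * l) =
          -(l - |c * ζ|) ^ 2 / (2 * l) := by
        rw [hM]
        field_simp
        linear_combination sq_abs (c * ζ)
      simp only [qs]
      rw [neg_div 2 (1 : ℝ), rpow_neg (by positivity), ← sqrt_eq_rpow,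
        sqrt_mul (by positivity), ← hexp, exp_add]
      field_simp
    rw [setIntegral_congr_fun measurableSet_Ioi h, integral_const_mul,
      integral_exp_neg_sub_sq_div_sqrt (abs_nonneg _)]
    exact inv_mul_cancel₀ (by positivity)
  have hqs : IntegrableOn qs (Set.Ioi 0) := integrable_of_integral_eq_one hint
  have hobj : ∀ l ∈ Set.Ioi (0 : ℝ), qs l * (log (qs l) + (1 / 2) * log (2 * π * l) +
      (l + c * ζ) ^ 2 / (2 * l)) = qs l * (2 * c * max 0 ζ) := fun l hl => by rw [hlog l hl]
  have hval : ∫ l in Set.Ioi (0 : ℝ), qs l * (log (qs l) + (1 / 2) * log (2 * π * l) +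
      (l + c * ζ) ^ 2 / (2 * l)) = 2 * c * max 0 ζ := by
    rw [setIntegral_congr_fun measurableSet_Ioi hobj, integral_mul_const, hint, one_mul]
  refine ⟨⟨fun l hl => (hpos l hl).le, hint⟩, hval, IsLeast.csInf_eq ⟨?_, ?_⟩⟩
  · refine ⟨qs, by fun_prop, fun l hl => (hpos l hl).le, hint, ?_, hval.symm⟩
    exact (integrableOn_congr_fun hobj measurableSet_Ioi).2 (hqs.mul_const _)
  · rintro r ⟨q, -, hq0, hq1, hqi, rfl⟩
    have hq : IntegrableOn q (Set.Ioi 0) := integrable_of_integral_eq_one hq1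
    calc 2 * c * max 0 ζ
        = ∫ l in Set.Ioi (0 : ℝ), (q l - qs l + q l * (2 * c * max 0 ζ)) := by
          rw [integral_add (f := fun l => q l - qs l) (hq.sub hqs) (hq.mul_const _),
            integral_sub hq hqs, integral_mul_const, hq1, hint]
          ring
      _ ≤ _ := by
          refine setIntegral_mono_on ((hq.sub hqs).add (hq.mul_const _)) hqi measurableSet_Ioi
            fun l hl => ?_
          rw [← hlog l hl]
          linarith [sub_le_mul_log_sub_log (hq0 l hl) (hpos l hl)]
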